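/- Let (G, <) be a well-ordered set and V a vector space over a field K with basis G. Then the map T ↦ ker(T) is a bijection between the set of reduction operators relative to (G, <) and the set of linear subspaces of V. -/

import Mathlib

/-- A reduction operator relative to a well-ordered set `(G, <)`: an idempotent
`K`-linear endomorphism `T` of `G →₀ K` such that `T g ≤ g` for every generator `g`. -/
def IsReductionOperator {K G : Type*} [Field K] [LinearOrder G]
    (T : (G →₀ K) →ₗ[K] (G →₀ K)) : Prop :=
  T ∘ₗ T = T ∧ ∀ g : G,
    T (Finsupp.single g 1) = Finsupp.single g 1 ∨
      ∀ h ∈ (T (Finsupp.single g 1)).support, h < g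

namespace IsReductionOperator

open Finsupp

variable {K G : Type*} [Field K] [LinearOrder G]

theorem supported_Iio_le_comap {T : (G →₀ K) →ₗ[K] (G →₀ K)} (hT : IsReductionOperator T)
    (g : G) : supported K K (Set.Iio g) ≤ (supported K K (Set.Iio g)).comap T := by
  conv_lhs => rw [supported_eq_span_single]
  rw [Submodule.span_le]
  rintro _ ⟨h, hh, rfl⟩
  simp only [SetLike.mem_coe, Submodule.mem_comap]
  rcases hT.2 h with e | e
  · rw [e]
    exact single_mem_supported K 1 hh
  · exact (mem_supported K _).2 fun x hx => (e x hx).trans hh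

theorem apply_apply_of_ker_eq {T S : (G →₀ K) →ₗ[K] (G →₀ K)} (hS : IsReductionOperator S)
    (h : LinearMap.ker T = LinearMap.ker S) (v : G →₀ K) : T (S v) = T v := by
  rw [← sub_eq_zero, ← map_sub, ← LinearMap.mem_ker, h, LinearMap.mem_ker, map_sub, sub_eq_zero]
  exact LinearMap.congr_fun hS.1 v

theorem apply_single_eq_of_ker_eq {T S : (G →₀ K) →ₗ[K] (G →₀ K)}
    (hT : IsReductionOperator T) (hS : IsReductionOperator S)
    (h : LinearMap.ker T = LinearMap.ker S) {g : G}
    (hg : T (single g 1) = single g 1) : S (single g 1) = single g 1 := by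
  refine (hS.2 g).resolve_right fun e => ?_
  have hm : T (S (single g 1)) ∈ supported K K (Set.Iio g) :=
    hT.supported_Iio_le_comap g ((mem_supported K _).2 e)
  rw [apply_apply_of_ker_eq hS h, hg, mem_supported] at hm
  exact lt_irrefl g (hm (by simp))

theorem eq_of_ker_eq [WellFoundedLT G] {T S : (G →₀ K) →ₗ[K] (G →₀ K)}
    (hT : IsReductionOperator T) (hS : IsReductionOperator S)
    (h : LinearMap.ker T = LinearMap.ker S) : T = S := by
  refine Finsupp.lhom_ext' fun g => LinearMap.ext_ring ?_
  simp only [LinearMap.comp_apply, lsingle_apply]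
  induction g using WellFoundedLT.induction with
  | ind g ih =>
    rcases hS.2 g with e | e
    · rw [e, apply_single_eq_of_ker_eq hS hT h.symm e]
    · have hle : supported K K (Set.Iio g) ≤ LinearMap.eqLocus T S := by
        rw [supported_eq_span_single, Submodule.span_le]
        rintro _ ⟨x, hx, rfl⟩
        exact ih x hx
      rw [← apply_apply_of_ker_eq hS h]
      exact (hle ((mem_supported K _).2 e)).trans (LinearMap.congr_fun hS.1 _)

/-- The leading generators of the nonzero elements of a subspace. -/
def leadingSet (W : Submodule K (G →₀ K)) : Set G :=
  {g | ∃ w ∈ W, w g ≠ 0 ∧ ∀ h ∈ w.support, h ≤ g}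

theorem disjoint_supported_compl_leadingSet (W : Submodule K (G →₀ K)) :
    Disjoint (supported K K (leadingSet W)ᶜ) W := by
  rw [Submodule.disjoint_def]
  intro w hN hW
  by_contra h0
  have hne : w.support.Nonempty := support_nonempty_iff.2 h0
  have hmem := w.support.max'_mem hne
  exact (mem_supported K w).1 hN hmem
    ⟨w, hW, mem_support_iff.1 hmem, fun h hh => w.support.le_max' h hh⟩

theorem single_mem_sup_supported [WellFoundedLT G] (W : Submodule K (G →₀ K)) (g : G) :
    single g 1 ∈ W ⊔ supported K K ((leadingSet W)ᶜ ∩ Set.Iic g) := by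
  induction g using WellFoundedLT.induction with
  | ind g ih =>
    by_cases hg : g ∈ leadingSet W
    · obtain ⟨w, hw, hwg, hle⟩ := hg
      have hlt : supported K K (Set.Iio g) ≤
          W ⊔ supported K K ((leadingSet W)ᶜ ∩ Set.Iic g) := by
        rw [supported_eq_span_single, Submodule.span_le]
        rintro _ ⟨x, hx, rfl⟩
        refine sup_le_sup_left (supported_mono ?_) W (ih x hx)
        exact Set.inter_subset_inter_right _ (Set.Iic_subset_Iic.2 (le_of_lt hx))
      have herase : w.erase g ∈ supported K K (Set.Iio g) := by
        refine (mem_supported K _).2 fun x hx => ?_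
        rw [support_erase, Finset.mem_coe, Finset.mem_erase] at hx
        exact lt_of_le_of_ne (hle x hx.2) hx.1
      have hsingle : single g (w g) ∈ W ⊔ supported K K ((leadingSet W)ᶜ ∩ Set.Iic g) := by
        rw [eq_sub_of_add_eq (single_add_erase g w)]
        exact Submodule.sub_mem _ (Submodule.mem_sup_left hw) (hlt herase)
      simpa [hwg] using Submodule.smul_mem _ (w g)⁻¹ hsingle
    · exact Submodule.mem_sup_right (single_mem_supported K 1 ⟨hg, le_refl g⟩)

theorem isCompl_supported_compl_leadingSet [WellFoundedLT G] (W : Submodule K (G →₀ K)) :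
    IsCompl (supported K K (leadingSet W)ᶜ) W := by
  refine ⟨disjoint_supported_compl_leadingSet W, codisjoint_iff_le_sup.2 ?_⟩
  rw [← supported_univ, supported_eq_span_single K Set.univ, Submodule.span_le]
  rintro _ ⟨g, -, rfl⟩
  rw [sup_comm]
  exact sup_le_sup_left (supported_mono Set.inter_subset_left) W (single_mem_sup_supported W g)

theorem projection_leadingSet [WellFoundedLT G] (W : Submodule K (G →₀ K)) :
    IsReductionOperator (Submodule.projection _ _ (isCompl_supported_compl_leadingSet W)) := by
  set hc := isCompl_supported_compl_leadingSet W
  refine ⟨Submodule.isIdempotentElem_projection hc, fun g => ?_⟩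
  by_cases hg : g ∈ leadingSet W
  · right
    obtain ⟨w, hw, n, hn, hwn⟩ := Submodule.mem_sup.1 (single_mem_sup_supported W g)
    have hn' : n ∈ supported K K (leadingSet W)ᶜ := supported_mono Set.inter_subset_left hn
    have hP : Submodule.projection _ _ hc (single g 1) = n := by
      rw [← hwn, map_add, (Submodule.projection_apply_eq_zero_iff hc).2 hw, zero_add]
      exact Submodule.projection_apply_left hc ⟨n, hn'⟩
    rw [hP]
    intro h hh
    obtain ⟨hL, hle⟩ := (mem_supported K n).1 hn hh
    exact lt_of_le_of_ne hle fun e => hL (e ▸ hg)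
  · left
    exact Submodule.projection_apply_left hc ⟨single g 1, single_mem_supported K 1 hg⟩

end IsReductionOperator

theorem stmt_0 {K G : Type*} [Field K] [LinearOrder G] [WellFoundedLT G] :
    Function.Bijective
      (fun T : {T : (G →₀ K) →ₗ[K] (G →₀ K) // IsReductionOperator T} =>
        LinearMap.ker T.1) := by
  refine ⟨fun T S h => Subtype.ext (T.2.eq_of_ker_eq S.2 h), fun W => ?_⟩
  exact ⟨⟨_, IsReductionOperator.projection_leadingSet W⟩, Submodule.ker_projection _⟩
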